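/- Let K be a field of characteristic p > 3, let G be a finite additive subgroup of K, and let L be the Lie algebra over K with basis (e_α)_{α ∈ G} and multiplication [e_α, e_β] = (β − α) e_{α+β} for α, β ∈ G. Then the vector space Z²_comm(L) of commutative 2-cocycles on L has dimension equal to |G| (= pⁿ). -/

import Mathlib

/-- The space `Z²_comm(L)` of commutative 2-cocycles on a Lie algebra `L`: symmetric bilinear
forms `φ : L × L → K` satisfying `φ([x,y],z) + φ([z,x],y) + φ([y,z],x) = 0`. -/
def commTwoCocycles (K L : Type*) [Field K] [LieRing L] [LieAlgebra K L] :
    Submodule K (L →ₗ[K] L →ₗ[K] K) where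
  carrier := {φ | (∀ x y : L, φ x y = φ y x) ∧
    ∀ x y z : L, φ ⁅x, y⁆ z + φ ⁅z, x⁆ y + φ ⁅y, z⁆ x = 0}
  zero_mem' := by
    refine ⟨fun x y => rfl, fun x y z => by simp⟩
  add_mem' := by
    rintro φ ψ ⟨hφ1, hφ2⟩ ⟨hψ1, hψ2⟩
    refine ⟨fun x y => ?_, fun x y z => ?_⟩
    · simp only [LinearMap.add_apply, hφ1 x y, hψ1 x y]
    · simp only [LinearMap.add_apply]
      linear_combination hφ2 x y z + hψ2 x y z
  smul_mem' := by
    rintro c φ ⟨h1, h2⟩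
    refine ⟨fun x y => ?_, fun x y z => ?_⟩
    · simp only [LinearMap.smul_apply, h1 x y]
    · simp only [LinearMap.smul_apply, smul_eq_mul]
      linear_combination c * h2 x y z

theorem zass_key (K : Type*) [Field K] (p : ℕ) [Fact p.Prime] [CharP K p] (hp : 3 < p)
    (G : AddSubgroup K) (F : G → G → K) (hs : ∀ a b, F a b = F b a)
    (hc : ∀ a b c : G, ((b : K) - a) * F (a + b) c + ((a : K) - c) * F (c + a) b
      + ((c : K) - b) * F (b + c) a = 0) (a b : G) : F a b = F (a + b) 0 := by
  have hpp : p.Prime := Fact.out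
  have hpG : ∀ x : G, p • x = 0 := fun x => by
    ext; simp
  have h2 : (2 : K) ≠ 0 := by
    intro h
    have : ((2 : ℕ) : K) = 0 := by exact_mod_cast h
    rw [CharP.cast_eq_zero_iff K p] at this
    exact absurd (Nat.le_of_dvd (by norm_num) this) (by omega)
  obtain ⟨s, hs3⟩ : ∃ s : G, s + s + s = a + b := by
    have hcop : Nat.Coprime 3 p := by
      rw [Nat.coprime_primes Nat.prime_three hpp]; omega
    obtain ⟨m, -, hm⟩ := Nat.exists_mul_mod_eq_one_of_coprime hcop (by omega)
    refine ⟨m • (a + b), ?_⟩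
    have h3 : (3 * m) = p * (3 * m / p) + 1 := by
      conv_lhs => rw [← Nat.div_add_mod (3 * m) p, hm]
    have : (3 * m) • (a + b) = a + b := by
      rw [h3, add_smul, mul_comm, mul_smul, hpG, smul_zero, zero_add, one_smul]
    calc _ = (3 * m) • (a + b) := by rw [mul_smul]; abel
      _ = _ := this
  let k : G → K := fun x => F (s + s - x) (s + x) - F (s + s) s
  have hk0 : k 0 = 0 := by simp [k]
  have hodd : ∀ x, k (-x) = - k x := by
    intro x
    by_cases hx : (x : K) = 0
    · have : x = 0 := by ext; simpa using hx
      subst this; simp [hk0]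
    have h := hc (s + x) (s - x) s
    have e1 : s + x + (s - x) = s + s := by abel
    have e2 : s + (s + x) = s + s - (-x) := by abel
    have e3 : s - x + s = s + s - x := by abel
    have e4 : s - x = s + (-x) := by abel
    rw [e1, e2, e3] at h
    simp only [AddSubgroup.coe_add, AddSubgroup.coe_sub] at h
    rw [e4] at h
    apply mul_left_cancel₀ hx
    simp only [k]
    linear_combination h
  have hsym : ∀ x, k (x + s) = - k x := by
    intro x
    rw [← hodd]
    simp only [k]
    rw [hs]
    congr 2 <;> abel
  have hit : ∀ (n : ℕ) x, k (x + n • s) = (-1) ^ n * k x := by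
    intro n
    induction n with
    | zero => intro x; simp
    | succ n ih =>
      intro x
      rw [succ_nsmul, ← add_assoc, hsym, ih]; ring
  have hk : ∀ x, k x = 0 := by
    intro x
    have h := hit p x
    rw [hpG, add_zero, (hpp.odd_of_ne_two (by omega)).neg_one_pow] at h
    have : 2 * k x = 0 := by linear_combination h
    exact (mul_eq_zero.mp this).resolve_left h2
  have key : ∀ c d : G, c + d = a + b → F c d = F (s + s) s := by
    intro c d hcd
    have h := hk (d - s)
    simp only [k] at h
    have e1 : s + s - (d - s) = c := by
      rw [eq_sub_of_add_eq hcd, ← hs3]; abel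
    have e2 : s + (d - s) = d := by abel
    rw [e1, e2] at h
    exact sub_eq_zero.mp h
  rw [key a b rfl, key (a + b) 0 (add_zero _)]

theorem zass_ext {K L ι : Type*} [Field K] [LieRing L] [LieAlgebra K L]
    (e : Module.Basis ι K L) (φ : L →ₗ[K] L →ₗ[K] K)
    (h : ∀ a b c, φ ⁅e a, e b⁆ (e c) + φ ⁅e c, e a⁆ (e b) + φ ⁅e b, e c⁆ (e a) = 0)
    (x y z : L) : φ ⁅x, y⁆ z + φ ⁅z, x⁆ y + φ ⁅y, z⁆ x = 0 := by
  have step : ∀ (P : L → K), (∀ u v, P (u + v) = P u + P v) → (∀ (t : K) u, P (t • u) = t * P u) →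
      (∀ i, P (e i) = 0) → ∀ x, P x = 0 := by
    intro P ha hm he x
    let Q : L →ₗ[K] K := { toFun := P, map_add' := ha, map_smul' := hm }
    have : Q = 0 := e.ext he
    exact LinearMap.congr_fun this x
  refine step (fun x => φ ⁅x, y⁆ z + φ ⁅z, x⁆ y + φ ⁅y, z⁆ x) ?_ ?_ (fun a => ?_) x
  · intro u v; simp; ring
  · intro t u; simp; ring
  refine step (fun y => φ ⁅e a, y⁆ z + φ ⁅z, e a⁆ y + φ ⁅y, z⁆ (e a)) ?_ ?_ (fun b => ?_) y
  · intro u v; simp; ring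
  · intro t u; simp; ring
  refine step (fun z => φ ⁅e a, e b⁆ z + φ ⁅z, e a⁆ (e b) + φ ⁅e b, z⁆ (e a)) ?_ ?_
    (fun c => h a b c) z
  · intro u v; simp; ring
  · intro t u; simp; ring

/-- Let `K` be a field of characteristic `p > 3`, `G` a finite additive
subgroup of `K`, and `L` the Lie algebra over `K` with basis `(e_α)_{α ∈ G}` and bracket
`[e_α, e_β] = (β − α) e_{α+β}` (the Zassenhaus algebra). Then the space `Z²_comm(L)` of
commutative 2-cocycles on `L` has dimension `|G|` (`= pⁿ`). -/
theorem zassenhaus_cocycle_dimension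
    (K : Type*) [Field K] (p : ℕ) [Fact p.Prime] [CharP K p] (hp : 3 < p)
    (G : AddSubgroup K) [Finite G]
    (L : Type*) [LieRing L] [LieAlgebra K L]
    (e : Module.Basis G K L)
    (he : ∀ α β : G, ⁅e α, e β⁆ = ((β : K) - (α : K)) • e (α + β)) :
    Module.finrank K (commTwoCocycles K L) = Nat.card G := by
  classical
  let T : commTwoCocycles K L →ₗ[K] (G → K) :=
    { toFun := fun φ σ => φ.1 (e σ) (e 0)
      map_add' := fun φ ψ => by ext; simp
      map_smul' := fun t φ => by ext; simp }
  have hbij : Function.Bijective T := by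
    constructor
    · intro φ φ' h0
      have hF : ∀ (φ : commTwoCocycles K L) (a b : G),
          φ.1 (e a) (e b) = φ.1 (e (a + b)) (e 0) := fun φ =>
        zass_key K p hp G (fun a b => φ.1 (e a) (e b)) (fun a b => φ.2.1 _ _)
          (fun a b c => by
            have h := φ.2.2 (e a) (e b) (e c)
            simpa [he] using h)
      apply Subtype.ext
      refine e.ext fun a => e.ext fun b => ?_
      rw [hF φ, hF φ']
      exact congrFun h0 (a + b)
    · intro ψ
      let φ : L →ₗ[K] L →ₗ[K] K := e.constr K fun a => e.constr K fun b => ψ (a + b)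
      have hφ : ∀ a b, φ (e a) (e b) = ψ (a + b) := by
        intro a b; simp [φ, Module.Basis.constr_basis]
      refine ⟨⟨φ, ?_, ?_⟩, ?_⟩
      · have : φ = φ.flip := by
          refine e.ext fun a => e.ext fun b => ?_
          rw [LinearMap.flip_apply, hφ, hφ, add_comm]
        intro x y
        conv_lhs => rw [this]
        rfl
      · apply zass_ext e
        intro a b c
        simp only [he, map_smul, LinearMap.smul_apply, hφ, smul_eq_mul]
        rw [show c + a + b = a + b + c by abel, show b + c + a = a + b + c by abel]
        ring
      · ext σ
        show φ (e σ) (e 0) = ψ σ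
        rw [hφ, add_zero]
  have := Fintype.ofFinite G
  rw [(LinearEquiv.ofBijective T hbij).finrank_eq, Module.finrank_fintype_fun_eq_card,
    Nat.card_eq_fintype_card]
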